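/- Let (X,d) be a complete geodesic metric space and let u, v : X → ℝ be locally Lipschitz functions. If u − v attains a local maximum at a point x̂ ∈ X, u is C^{1,+} and v is C^{1,−}, then |∇u|(x̂) = |∇v|(x̂). -/

import Mathlib

open Filter Metric Set Topology

/-- Local slope of `u` at `x`, relative to a set `s` and a distance-like function `ρ`. -/
noncomputable def slopeWrt {α : Type*} [TopologicalSpace α] (s : Set α) (ρ : α → α → ℝ)
    (u : α → ℝ) (x : α) : ℝ :=
  Filter.limsup (fun y => |u y - u x| / ρ x y) (nhdsWithin x (s \ {x}))

/-- Upper local slope. -/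
noncomputable def upperSlopeWrt {α : Type*} [TopologicalSpace α] (s : Set α) (ρ : α → α → ℝ)
    (u : α → ℝ) (x : α) : ℝ :=
  Filter.limsup (fun y => max (u y - u x) 0 / ρ x y) (nhdsWithin x (s \ {x}))

/-- Lower local slope. -/
noncomputable def lowerSlopeWrt {α : Type*} [TopologicalSpace α] (s : Set α) (ρ : α → α → ℝ)
    (u : α → ℝ) (x : α) : ℝ :=
  Filter.limsup (fun y => max (u x - u y) 0 / ρ x y) (nhdsWithin x (s \ {x}))

/-- `u` is locally Lipschitz on `s` with respect to `ρ`. -/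
def LocLipWrt {α : Type*} [TopologicalSpace α] (s : Set α) (ρ : α → α → ℝ)
    (u : α → ℝ) : Prop :=
  ∀ x ∈ s, ∃ K : ℝ, ∃ t ∈ nhdsWithin x s, ∀ y ∈ t ∩ s, ∀ z ∈ t ∩ s, |u y - u z| ≤ K * ρ y z

/-- `u` is of class `C^{1,-}`: locally Lipschitz, with continuous local slope which
coincides with the lower local slope. -/
def IsC1MinusWrt {α : Type*} [TopologicalSpace α] (s : Set α) (ρ : α → α → ℝ)
    (u : α → ℝ) : Prop :=
  LocLipWrt s ρ u ∧ ContinuousOn (slopeWrt s ρ u) s ∧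
    ∀ x ∈ s, lowerSlopeWrt s ρ u x = slopeWrt s ρ u x

/-- `u` is of class `C^{1,+}`: locally Lipschitz, with continuous local slope which
coincides with the upper local slope. -/
def IsC1PlusWrt {α : Type*} [TopologicalSpace α] (s : Set α) (ρ : α → α → ℝ)
    (u : α → ℝ) : Prop :=
  LocLipWrt s ρ u ∧ ContinuousOn (slopeWrt s ρ u) s ∧
    ∀ x ∈ s, upperSlopeWrt s ρ u x = slopeWrt s ρ u x

/-- Upper semicontinuous envelope of `u` relative to `s`. -/
noncomputable def uscWrt {α : Type*} [TopologicalSpace α] (s : Set α) (u : α → ℝ) (x : α) : ℝ :=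
  Filter.limsup u (nhdsWithin x s)

/-- Lower semicontinuous envelope of `u` relative to `s`. -/
noncomputable def lscWrt {α : Type*} [TopologicalSpace α] (s : Set α) (u : α → ℝ) (x : α) : ℝ :=
  Filter.liminf u (nhdsWithin x s)

/-- `H_a(x,r,p) = inf { H x r q | q ≥ 0, |q - p| ≤ a }`. -/
noncomputable def Hlow {α : Type*} (H : α → ℝ → ℝ → ℝ) (a : ℝ) (x : α) (r p : ℝ) : ℝ :=
  sInf (H x r '' {q | 0 ≤ q ∧ |q - p| ≤ a})

/-- `H^a(x,r,p) = sup { H x r q | q ≥ 0, |q - p| ≤ a }`. -/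
noncomputable def Hupp {α : Type*} (H : α → ℝ → ℝ → ℝ) (a : ℝ) (x : α) (r p : ℝ) : ℝ :=
  sSup (H x r '' {q | 0 ≤ q ∧ |q - p| ≤ a})

/-- Metric viscosity subsolution of `H(x, u, |∇u|) = 0` on the space `(s, ρ)`. -/
def IsMVSubsolutionWrt {α : Type*} [TopologicalSpace α] (s : Set α) (ρ : α → α → ℝ)
    (H : α → ℝ → ℝ → ℝ) (u : α → ℝ) : Prop :=
  ∀ ψ₁ ψ₂ : α → ℝ, IsC1MinusWrt s ρ ψ₁ → LocLipWrt s ρ ψ₂ →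
    ∀ x ∈ s, IsLocalMaxOn (fun y => uscWrt s u y - (ψ₁ y + ψ₂ y)) s x →
      Hlow H (uscWrt s (slopeWrt s ρ ψ₂) x) x (uscWrt s u x) (slopeWrt s ρ ψ₁ x) ≤ 0

/-- Metric viscosity supersolution of `H(x, u, |∇u|) = 0` on the space `(s, ρ)`. -/
def IsMVSupersolutionWrt {α : Type*} [TopologicalSpace α] (s : Set α) (ρ : α → α → ℝ)
    (H : α → ℝ → ℝ → ℝ) (u : α → ℝ) : Prop :=
  ∀ ψ₁ ψ₂ : α → ℝ, IsC1PlusWrt s ρ ψ₁ → LocLipWrt s ρ ψ₂ →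
    ∀ x ∈ s, IsLocalMinOn (fun y => lscWrt s u y - (ψ₁ y + ψ₂ y)) s x →
      0 ≤ Hupp H (uscWrt s (slopeWrt s ρ ψ₂) x) x (lscWrt s u x) (slopeWrt s ρ ψ₁ x)

/-- `(s, ρ)` is a geodesic space: any two points are joined by an isometric
embedding of the interval `[0, ρ x y]`. -/
def IsGeodesicWrt {α : Type*} (s : Set α) (ρ : α → α → ℝ) : Prop :=
  ∀ x ∈ s, ∀ y ∈ s, ∃ γ : ℝ → α, γ 0 = x ∧ γ (ρ x y) = y ∧
    (∀ t ∈ Icc (0:ℝ) (ρ x y), γ t ∈ s) ∧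
    ∀ t₁ ∈ Icc (0:ℝ) (ρ x y), ∀ t₂ ∈ Icc (0:ℝ) (ρ x y), ρ (γ t₁) (γ t₂) = |t₁ - t₂|

/-- Strict local maximum of `f` on `s` at `x`. -/
def IsStrictLocalMaxOn' {α : Type*} [TopologicalSpace α] (f : α → ℝ) (s : Set α) (x : α) : Prop :=
  ∀ᶠ y in nhdsWithin x (s \ {x}), f y < f x

/-- Strict local minimum of `f` on `s` at `x`. -/
def IsStrictLocalMinOn' {α : Type*} [TopologicalSpace α] (f : α → ℝ) (s : Set α) (x : α) : Prop :=
  ∀ᶠ y in nhdsWithin x (s \ {x}), f x < f y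

/-- `u` is locally bounded on `s`. -/
def LocBddWrt {α : Type*} [TopologicalSpace α] (s : Set α) (u : α → ℝ) : Prop :=
  ∀ x ∈ s, ∃ C : ℝ, ∀ᶠ y in nhdsWithin x s, |u y| ≤ C

/-- `ρ` is a metric on the subset `S` of the ambient metric space `Y`, bounded below by the
ambient distance and inducing the subspace topology on `S`. -/
structure IsMetricOn {Y : Type*} [MetricSpace Y] (S : Set Y) (ρ : Y → Y → ℝ) : Prop where
  refl : ∀ x ∈ S, ρ x x = 0
  symm : ∀ x ∈ S, ∀ y ∈ S, ρ x y = ρ y x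
  triangle : ∀ x ∈ S, ∀ y ∈ S, ∀ z ∈ S, ρ x z ≤ ρ x y + ρ y z
  ge_dist : ∀ x ∈ S, ∀ y ∈ S, dist x y ≤ ρ x y
  nhds_basis : ∀ x ∈ S, (nhdsWithin x S).HasBasis (fun ε : ℝ => 0 < ε)
    (fun ε => {y | y ∈ S ∧ ρ x y < ε})

/-- Spatial local slope of `ψ : (0,∞) × X → ℝ` at `z = (t, x)`. -/
noncomputable def slopeSpWrt {α : Type*} [TopologicalSpace α] (s : Set α) (ρ : α → α → ℝ)
    (ψ : ℝ × α → ℝ) (z : ℝ × α) : ℝ :=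
  Filter.limsup (fun y => |ψ (z.1, y) - ψ z| / ρ z.2 y) (nhdsWithin z.2 (s \ {z.2}))

/-- Spatial upper local slope. -/
noncomputable def upperSlopeSpWrt {α : Type*} [TopologicalSpace α] (s : Set α) (ρ : α → α → ℝ)
    (ψ : ℝ × α → ℝ) (z : ℝ × α) : ℝ :=
  Filter.limsup (fun y => max (ψ (z.1, y) - ψ z) 0 / ρ z.2 y) (nhdsWithin z.2 (s \ {z.2}))

/-- Spatial lower local slope. -/
noncomputable def lowerSlopeSpWrt {α : Type*} [TopologicalSpace α] (s : Set α) (ρ : α → α → ℝ)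
    (ψ : ℝ × α → ℝ) (z : ℝ × α) : ℝ :=
  Filter.limsup (fun y => max (ψ z - ψ (z.1, y)) 0 / ρ z.2 y) (nhdsWithin z.2 (s \ {z.2}))

/-- Product (max) metric on `ℝ × α` built from `ρ`. -/
def prodMet {α : Type*} (ρ : α → α → ℝ) : ℝ × α → ℝ × α → ℝ :=
  fun z w => max |z.1 - w.1| (ρ z.2 w.2)

/-- Metric viscosity subsolution of `∂ₜ u + H(t, x, u, |∇u|) = 0` on `(0,∞) × (s, ρ)`. -/
def IsMVSubsolutionTWrt {α : Type*} [TopologicalSpace α] (s : Set α) (ρ : α → α → ℝ)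
    (H : ℝ → α → ℝ → ℝ → ℝ) (u : ℝ × α → ℝ) : Prop :=
  ∀ ψ₁ ψ₂ dψ₁ dψ₂ : ℝ × α → ℝ,
    LocLipWrt (Ioi (0:ℝ) ×ˢ s) (prodMet ρ) ψ₁ →
    LocLipWrt (Ioi (0:ℝ) ×ˢ s) (prodMet ρ) ψ₂ →
    (∀ z ∈ Ioi (0:ℝ) ×ˢ s, HasDerivAt (fun τ => ψ₁ (τ, z.2)) (dψ₁ z) z.1) →
    ContinuousOn dψ₁ (Ioi (0:ℝ) ×ˢ s) →
    (∀ z ∈ Ioi (0:ℝ) ×ˢ s, HasDerivAt (fun τ => ψ₂ (τ, z.2)) (dψ₂ z) z.1) →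
    ContinuousOn dψ₂ (Ioi (0:ℝ) ×ˢ s) →
    ContinuousOn (slopeSpWrt s ρ ψ₁) (Ioi (0:ℝ) ×ˢ s) →
    (∀ z ∈ Ioi (0:ℝ) ×ˢ s, lowerSlopeSpWrt s ρ ψ₁ z = slopeSpWrt s ρ ψ₁ z) →
    ∀ z ∈ Ioi (0:ℝ) ×ˢ s,
      IsLocalMaxOn (fun w => uscWrt (Ioi (0:ℝ) ×ˢ s) u w - (ψ₁ w + ψ₂ w))
        (Ioi (0:ℝ) ×ˢ s) z →
      dψ₁ z + dψ₂ z +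
        Hlow (fun w : ℝ × α => H w.1 w.2)
          (uscWrt (Ioi (0:ℝ) ×ˢ s) (slopeSpWrt s ρ ψ₂) z) z
          (uscWrt (Ioi (0:ℝ) ×ˢ s) u z) (slopeSpWrt s ρ ψ₁ z) ≤ 0

/-- Metric viscosity supersolution of `∂ₜ u + H(t, x, u, |∇u|) = 0` on `(0,∞) × (s, ρ)`. -/
def IsMVSupersolutionTWrt {α : Type*} [TopologicalSpace α] (s : Set α) (ρ : α → α → ℝ)
    (H : ℝ → α → ℝ → ℝ → ℝ) (u : ℝ × α → ℝ) : Prop :=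
  ∀ ψ₁ ψ₂ dψ₁ dψ₂ : ℝ × α → ℝ,
    LocLipWrt (Ioi (0:ℝ) ×ˢ s) (prodMet ρ) ψ₁ →
    LocLipWrt (Ioi (0:ℝ) ×ˢ s) (prodMet ρ) ψ₂ →
    (∀ z ∈ Ioi (0:ℝ) ×ˢ s, HasDerivAt (fun τ => ψ₁ (τ, z.2)) (dψ₁ z) z.1) →
    ContinuousOn dψ₁ (Ioi (0:ℝ) ×ˢ s) →
    (∀ z ∈ Ioi (0:ℝ) ×ˢ s, HasDerivAt (fun τ => ψ₂ (τ, z.2)) (dψ₂ z) z.1) →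
    ContinuousOn dψ₂ (Ioi (0:ℝ) ×ˢ s) →
    ContinuousOn (slopeSpWrt s ρ ψ₁) (Ioi (0:ℝ) ×ˢ s) →
    (∀ z ∈ Ioi (0:ℝ) ×ˢ s, upperSlopeSpWrt s ρ ψ₁ z = slopeSpWrt s ρ ψ₁ z) →
    ∀ z ∈ Ioi (0:ℝ) ×ˢ s,
      IsLocalMinOn (fun w => lscWrt (Ioi (0:ℝ) ×ˢ s) u w - (ψ₁ w + ψ₂ w))
        (Ioi (0:ℝ) ×ˢ s) z →
      0 ≤ dψ₁ z + dψ₂ z +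
        Hupp (fun w : ℝ × α => H w.1 w.2)
          (uscWrt (Ioi (0:ℝ) ×ˢ s) (slopeSpWrt s ρ ψ₂) z) z
          (lscWrt (Ioi (0:ℝ) ×ˢ s) u z) (slopeSpWrt s ρ ψ₁ z)

/-- The difference quotients of a locally Lipschitz function are bounded near each point. -/
theorem LocLipWrt.isBoundedUnder_abs_div_dist {X : Type*} [MetricSpace X] {u : X → ℝ}
    (hu : LocLipWrt (univ : Set X) dist u) (x : X) :
    IsBoundedUnder (· ≤ ·) (𝓝[univ \ {x}] x) (fun y => |u y - u x| / dist x y) := by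
  obtain ⟨K, t, ht, h⟩ := hu x (mem_univ x)
  refine ⟨K, eventually_map.2 ?_⟩
  have hx : x ∈ t := mem_of_mem_nhdsWithin (mem_univ x) ht
  filter_upwards [nhdsWithin_mono x (subset_univ _) ht, self_mem_nhdsWithin] with y hy hyx
  have hpos : 0 < dist x y := dist_pos.2 (Ne.symm hyx.2)
  rw [div_le_iff₀ hpos, dist_comm]
  exact h y ⟨hy, mem_univ y⟩ x ⟨hx, mem_univ x⟩

/-- A nonnegative numerator eventually dominated by the oscillation of a locally Lipschitz
function has upper limit at most its local slope. -/
theorem limsup_div_dist_le_slopeWrt {X : Type*} [MetricSpace X] {w : X → ℝ}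
    (hw : LocLipWrt (univ : Set X) dist w) {x : X} {g : X → ℝ} (hg : ∀ y, 0 ≤ g y)
    (hgw : ∀ᶠ y in 𝓝 x, g y ≤ |w y - w x|) :
    limsup (fun y => g y / dist x y) (𝓝[univ \ {x}] x) ≤ slopeWrt univ dist w x := by
  unfold slopeWrt
  rcases (𝓝[univ \ {x}] x).eq_or_neBot with hbot | hne
  · simp [hbot, limsup, limsSup]
  · refine limsup_le_limsup ?_ ?_ (hw.isBoundedUnder_abs_div_dist x)
    · filter_upwards [nhdsWithin_le_nhds hgw] with y hy
      gcongr
    · exact (isBoundedUnder_of ⟨0, fun y => div_nonneg (hg y) dist_nonneg⟩ :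
        IsBoundedUnder (· ≥ ·) _ _).isCoboundedUnder_le

/-- maximum principle, fourth item. -/
theorem stmt3 {X : Type*} [MetricSpace X] [CompleteSpace X]
    (hgeo : IsGeodesicWrt (univ : Set X) dist)
    (u v : X → ℝ)
    (hu : LocLipWrt (univ : Set X) dist u) (hv : LocLipWrt (univ : Set X) dist v)
    (xhat : X) (hmax : IsLocalMax (fun x => u x - v x) xhat)
    (huC : IsC1PlusWrt (univ : Set X) dist u)
    (hvC : IsC1MinusWrt (univ : Set X) dist v) :
    slopeWrt (univ : Set X) dist u xhat = slopeWrt (univ : Set X) dist v xhat := by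
  apply le_antisymm
  · rw [← huC.2.2 xhat (mem_univ _)]
    refine limsup_div_dist_le_slopeWrt hv (fun y => le_max_right _ _) ?_
    filter_upwards [hmax] with y hy
    exact max_le (le_trans (by linarith) (le_abs_self _)) (abs_nonneg _)
  · rw [← hvC.2.2 xhat (mem_univ _)]
    refine limsup_div_dist_le_slopeWrt hu (fun y => le_max_right _ _) ?_
    filter_upwards [hmax] with y hy
    exact max_le (le_trans (by linarith) (neg_le_abs _)) (abs_nonneg _)
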